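/- arXiv:1112.1468 — 5 statements merged into one kernel-verified Lean document; each statement's English description precedes it below -/
import Mathlib

section
/- The group G = G̃/N has cardinality 2(p−1)p(p+1). -/
noncomputable section

/-- `G̃ ⊆ GL₂(F_p) × F_{p²}ˣ`: the subgroup of pairs `(σ, u)` with `det σ = u²`. -/
def Gtilde (p : ℕ) [Fact p.Prime] :
    Subgroup (GL (Fin 2) (ZMod p) × (GaloisField p 2)ˣ) :=
  MonoidHom.eqLocus
    ((Units.map (algebraMap (ZMod p) (GaloisField p 2)).toMonoidHom).comp
      ((Matrix.GeneralLinearGroup.det).comp (MonoidHom.fst _ _)))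
    ((powMonoidHom 2).comp (MonoidHom.snd _ _))

/-- The homomorphism `λ ↦ (λ·I, λ^{(p+1)/2})`. -/
def scalarPair (p : ℕ) [Fact p.Prime] :
    (ZMod p)ˣ →* GL (Fin 2) (ZMod p) × (GaloisField p 2)ˣ :=
  (Units.map (Matrix.scalar (Fin 2)).toMonoidHom).prod
    ((powMonoidHom ((p + 1) / 2)).comp
      (Units.map (algebraMap (ZMod p) (GaloisField p 2)).toMonoidHom))

/-- The central subgroup `N = {(λ·I, λ^{(p+1)/2}) : λ ∈ F_pˣ}` of `G̃`. -/
def Ncen (p : ℕ) [Fact p.Prime] : Subgroup (Gtilde p) :=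
  Subgroup.comap (Gtilde p).subtype (scalarPair p).range

lemma scalarPair_central (p : ℕ) [Fact p.Prime] (lam : (ZMod p)ˣ)
    (h : GL (Fin 2) (ZMod p) × (GaloisField p 2)ˣ) :
    h * scalarPair p lam = scalarPair p lam * h := by
  refine Prod.ext ?_ ?_
  · apply Units.ext
    show (h.1 : Matrix (Fin 2) (Fin 2) (ZMod p)) * Matrix.scalar (Fin 2) (lam : ZMod p) =
      Matrix.scalar (Fin 2) (lam : ZMod p) * (h.1 : Matrix (Fin 2) (Fin 2) (ZMod p))
    exact (Matrix.scalar_commute (lam : ZMod p) (fun r => Commute.all _ r)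
      (h.1 : Matrix (Fin 2) (Fin 2) (ZMod p))).eq.symm
  · exact mul_comm _ _

instance Ncen_normal (p : ℕ) [Fact p.Prime] : (Ncen p).Normal := by
  constructor
  intro n hn g
  rw [Ncen, Subgroup.mem_comap, MonoidHom.mem_range] at hn ⊢
  obtain ⟨lam, hlam⟩ := hn
  refine ⟨lam, ?_⟩
  have : (Gtilde p).subtype (g * n * g⁻¹)
      = (g : GL (Fin 2) (ZMod p) × (GaloisField p 2)ˣ) * (Gtilde p).subtype n * (g : _)⁻¹ := by
    simp [map_mul]
  rw [this, ← hlam, scalarPair_central, mul_assoc]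
  simp

/-- `G = G̃/N`. -/
abbrev Gquot (p : ℕ) [Fact p.Prime] : Type := Gtilde p ⧸ Ncen p

/-- `θ : SL₂(F_p) → G`, sending `σ` to the class of `(σ, 1)`. -/
def theta (p : ℕ) [Fact p.Prime] :
    Matrix.SpecialLinearGroup (Fin 2) (ZMod p) →* Gquot p :=
  (QuotientGroup.mk' (Ncen p)).comp
    (MonoidHom.codRestrict ((Matrix.SpecialLinearGroup.toGL).prod 1) (Gtilde p)
      (by
        intro σ
        show (Units.map (algebraMap (ZMod p) (GaloisField p 2)).toMonoidHom)
            (Matrix.GeneralLinearGroup.det (Matrix.SpecialLinearGroup.toGL σ)) = (1 : (GaloisField p 2)ˣ) ^ 2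
        have hdet : Matrix.GeneralLinearGroup.det (Matrix.SpecialLinearGroup.toGL σ) = 1 := by
          apply Units.ext
          show Matrix.det (σ : Matrix (Fin 2) (Fin 2) (ZMod p)) = 1
          exact σ.prop
        rw [hdet, map_one, one_pow]))

/-- Every element of `F_pˣ` becomes a square in `F_{p²}ˣ`. -/
lemma exists_sqrt_aux (p : ℕ) [Fact p.Prime] (hp2 : 2 < p) (a : (ZMod p)ˣ) :
    ∃ u : (GaloisField p 2)ˣ,
      Units.map (algebraMap (ZMod p) (GaloisField p 2)).toMonoidHom a = u ^ 2 := by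
  haveI : Fintype (GaloisField p 2) := Fintype.ofFinite _
  have hchar : ringChar (GaloisField p 2) ≠ 2 := by
    rw [ringChar.eq (GaloisField p 2) p]; omega
  have hcard : Fintype.card (GaloisField p 2) = p ^ 2 := by
    rw [← Nat.card_eq_fintype_card]; exact GaloisField.card p 2 (by norm_num)
  have hodd : p % 2 = 1 := (Fact.out : p.Prime).eq_two_or_odd.resolve_left (by omega)
  obtain ⟨k, hk⟩ : ∃ k, p = 2 * k + 1 := ⟨p / 2, by omega⟩
  have hexp : p ^ 2 / 2 = (p - 1) * (k + 1) := by
    have h1 : p - 1 = 2 * k := by omega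
    have h2 : p ^ 2 = 2 * (2 * k * (k + 1)) + 1 := by rw [hk]; ring
    rw [h1, h2]; omega
  have hs := (FiniteField.unit_isSquare_iff hchar
    (Units.map (algebraMap (ZMod p) (GaloisField p 2)).toMonoidHom a)).2 (by
      rw [hcard, hexp, ← map_pow, pow_mul, ZMod.units_pow_card_sub_one_eq_one, one_pow, map_one])
  obtain ⟨u, hu⟩ := hs
  exact ⟨u, by rw [hu, sq]⟩

lemma mem_Gtilde_iff (p : ℕ) [Fact p.Prime] (x : GL (Fin 2) (ZMod p) × (GaloisField p 2)ˣ) :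
    x ∈ Gtilde p ↔ Units.map (algebraMap (ZMod p) (GaloisField p 2)).toMonoidHom
      (Matrix.GeneralLinearGroup.det x.1) = x.2 ^ 2 := Iff.rfl

lemma card_Gtilde (p : ℕ) [Fact p.Prime] (hp2 : 2 < p) :
    Nat.card (Gtilde p) = Nat.card (GL (Fin 2) (ZMod p)) * 2 := by
  let f : Gtilde p →* GL (Fin 2) (ZMod p) := (MonoidHom.fst _ _).comp (Gtilde p).subtype
  have hf : Function.Surjective f := by
    intro σ
    obtain ⟨u, hu⟩ := exists_sqrt_aux p hp2 (Matrix.GeneralLinearGroup.det σ)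
    exact ⟨⟨(σ, u), hu⟩, rfl⟩
  have hne : (1 : (GaloisField p 2)ˣ) ≠ -1 := by
    intro h
    have h' : (1 : GaloisField p 2) = -1 := by simpa using congrArg Units.val h
    exact Ring.neg_one_ne_one_of_char_ne_two
      (by rw [ringChar.eq (GaloisField p 2) p]; omega) h'.symm
  have hker : Nat.card f.ker = 2 := by
    let e : f.ker ≃ ({1, -1} : Set (GaloisField p 2)ˣ) :=
      { toFun := fun x => ⟨x.1.1.2, by
          have h1 : x.1.1.1 = 1 := x.2
          have h2 := (mem_Gtilde_iff p _).1 x.1.2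
          rw [h1, map_one, map_one] at h2
          have h3 : ((x.1.1.2 : (GaloisField p 2)ˣ) : GaloisField p 2) ^ 2 = 1 := by
            rw [← Units.val_pow_eq_pow_val, ← h2, Units.val_one]
          rcases (mul_self_eq_one_iff.1 ((sq _).symm.trans h3)) with h | h
          · left; exact Units.ext h
          · right; exact Units.ext (by simpa using h)⟩
        invFun := fun u => ⟨⟨(1, u.1), by
          rw [mem_Gtilde_iff]
          rcases u.2 with h | h
          · simp [h]
          · rw [Set.mem_singleton_iff.1 h]; simp⟩, rfl⟩
        left_inv := fun x => by
          have h1 : x.1.1.1 = 1 := x.2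
          apply Subtype.ext; apply Subtype.ext
          exact Prod.ext h1.symm rfl
        right_inv := fun u => rfl }
    rw [Nat.card_congr e, Nat.card_coe_set_eq, Set.ncard_pair hne]
  rw [Subgroup.card_eq_card_quotient_mul_card_subgroup f.ker, hker,
    Nat.card_congr (QuotientGroup.quotientKerEquivOfSurjective f hf).toEquiv]

lemma scalarPair_mem (p : ℕ) [Fact p.Prime] (hp2 : 2 < p) (a : (ZMod p)ˣ) :
    scalarPair p a ∈ Gtilde p := by
  have hodd : p % 2 = 1 := (Fact.out : p.Prime).eq_two_or_odd.resolve_left (by omega)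
  have hdet : Matrix.GeneralLinearGroup.det (scalarPair p a).1 = a ^ 2 := by
    apply Units.ext
    show Matrix.det (Matrix.scalar (Fin 2) (a : ZMod p)) = _
    simp
  rw [mem_Gtilde_iff, hdet]
  show _ = ((Units.map (algebraMap (ZMod p) (GaloisField p 2)).toMonoidHom a) ^ ((p + 1) / 2)) ^ 2
  rw [← pow_mul, ← map_pow]
  have h : (p + 1) / 2 * 2 = (p - 1) + 2 := by omega
  rw [h, pow_add, ZMod.units_pow_card_sub_one_eq_one, one_mul]

lemma card_Ncen (p : ℕ) [Fact p.Prime] (hp2 : 2 < p) : Nat.card (Ncen p) = p - 1 := by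
  have hinj : Function.Injective (scalarPair p) := by
    intro a b h
    have h1 : Matrix.scalar (Fin 2) (a : ZMod p) = Matrix.scalar (Fin 2) (b : ZMod p) :=
      congrArg (fun x => (x.1 : Matrix (Fin 2) (Fin 2) (ZMod p))) h
    exact Units.ext (Matrix.scalar_inj.1 h1)
  have hle : (scalarPair p).range ≤ Gtilde p := by
    rintro _ ⟨a, rfl⟩
    exact scalarPair_mem p hp2 a
  have e1 : Nat.card (Ncen p) = Nat.card (scalarPair p).range :=
    Nat.card_congr (Subgroup.subgroupOfEquivOfLe hle).toEquiv
  rw [e1, ← Nat.card_congr (MonoidHom.ofInjective hinj).toEquiv, Nat.card_eq_fintype_card,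
    ZMod.card_units]

/-- The group `G = G̃/N` has cardinality `2(p−1)p(p+1)`. -/
theorem stmt_3 (p : ℕ) [Fact p.Prime] (hp2 : 2 < p) :
    Nat.card (Gquot p) = 2 * (p - 1) * p * (p + 1) := by
  have h1 := Subgroup.card_eq_card_quotient_mul_card_subgroup (Ncen p)
  rw [card_Gtilde p hp2, card_Ncen p hp2, Matrix.card_GL_field] at h1
  obtain ⟨k, rfl⟩ : ∃ k, p = k + 1 := ⟨p - 1, by omega⟩
  simp only [Fin.prod_univ_two, ZMod.card, Fin.val_zero, Fin.val_one, pow_zero, pow_one,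
    Nat.add_sub_cancel] at h1 ⊢
  have h2 : (k + 1) ^ 2 - 1 = k * (k + 2) := by
    have : (k + 1) ^ 2 = k * (k + 2) + 1 := by ring
    omega
  have h3 : (k + 1) ^ 2 - (k + 1) = k * (k + 1) := by
    have : (k + 1) ^ 2 = k * (k + 1) + (k + 1) := by ring
    omega
  rw [h2, h3] at h1
  have hk : 0 < k := by omega
  apply Nat.eq_of_mul_eq_mul_right hk
  rw [← h1]; ring
end
end

section
/- If p ≡ 1 (mod 4), then the group homomorphism θ : SL₂(F_p) → G sending σ to the class of (σ, 1) is injective, i.e., its kernel is the trivial subgroup. -/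
noncomputable section

/-- If `p ≡ 1 (mod 4)`, then `θ : SL₂(F_p) → G` is injective, i.e. its
kernel is the trivial subgroup. -/
theorem stmt_4 (p : ℕ) [Fact p.Prime] (hp2 : 2 < p) (hp4 : p % 4 = 1) :
    (theta p).ker = ⊥ := by
  rw [eq_bot_iff]
  intro σ hσ
  rw [MonoidHom.mem_ker] at hσ
  have h1 := (QuotientGroup.eq_one_iff _).mp hσ
  rw [Ncen, Subgroup.mem_comap, MonoidHom.mem_range] at h1
  obtain ⟨lam, hlam⟩ := h1
  have hm : Matrix.scalar (Fin 2) (lam : ZMod p) = (σ : Matrix (Fin 2) (Fin 2) (ZMod p)) :=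
    congrArg (fun x => (x.1 : Matrix (Fin 2) (Fin 2) (ZMod p))) hlam
  have hu : (algebraMap (ZMod p) (GaloisField p 2) (lam : ZMod p)) ^ ((p + 1) / 2) = 1 :=
    congrArg (fun x => (x.2 : GaloisField p 2)) hlam
  have hl : (lam : ZMod p) ^ ((p + 1) / 2) = 1 := by
    apply (algebraMap (ZMod p) (GaloisField p 2)).injective
    rw [map_pow, hu, map_one]
  have hd : (lam : ZMod p) ^ 2 = 1 := by
    have h := σ.prop
    rw [← hm] at h
    simpa using h
  obtain ⟨k, hk⟩ : ∃ k, (p + 1) / 2 = 2 * k + 1 := ⟨p / 4, by omega⟩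
  rw [hk, pow_succ, pow_mul, hd, one_pow, one_mul] at hl
  rw [Subgroup.mem_bot]
  apply Subtype.ext
  rw [← hm, hl, map_one]
  rfl
end
end

section
/- If p ≡ 3 (mod 4), then the kernel of the group homomorphism θ : SL₂(F_p) → G sending σ to the class of (σ, 1) is the two-element subgroup {I, −I} of SL₂(F_p). -/
noncomputable section

instance : Fact (Even (Fintype.card (Fin 2))) := ⟨⟨1, rfl⟩⟩

/-- If `p ≡ 3 (mod 4)`, then the kernel of `θ : SL₂(F_p) → G` is the
two-element subgroup `{I, −I}` of `SL₂(F_p)`. -/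
theorem stmt_5 (p : ℕ) [Fact p.Prime] (hp2 : 2 < p) (hp4 : p % 4 = 3) :
    ((theta p).ker : Set (Matrix.SpecialLinearGroup (Fin 2) (ZMod p)))
      = {1, -1} := by
  have key : ∀ σ, σ ∈ (theta p).ker ↔
      ∃ lam, scalarPair p lam = ((Matrix.SpecialLinearGroup.toGL σ, 1) :
        GL (Fin 2) (ZMod p) × (GaloisField p 2)ˣ) := by
    intro σ
    rw [MonoidHom.mem_ker]
    exact QuotientGroup.eq_one_iff (N := Ncen p) _
  ext σ
  rw [SetLike.mem_coe, key]
  constructor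
  · rintro ⟨lam, h⟩
    have h1 : Matrix.scalar (Fin 2) (lam : ZMod p) = (σ : Matrix (Fin 2) (Fin 2) (ZMod p)) :=
      congrArg (fun x => (x.1 : Matrix (Fin 2) (Fin 2) (ZMod p))) h
    have h2 : (lam : ZMod p) * lam = 1 := by
      have := σ.prop
      rw [← h1, Matrix.det_fin_two] at this
      simpa using this
    rcases mul_self_eq_one_iff.mp h2 with h3 | h3
    · left
      apply Subtype.ext
      rw [← h1, h3, map_one]
      rfl
    · right
      apply Subtype.ext
      rw [← h1, h3, map_neg, map_one]
      rfl
  · rintro (rfl | h)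
    · exact ⟨1, by simp only [map_one]; rfl⟩
    · obtain rfl : σ = -1 := h
      refine ⟨-1, Prod.ext ?_ ?_⟩
      · apply Units.ext
        show Matrix.scalar (Fin 2) (-1 : ZMod p) = -1
        rw [map_neg, map_one]
      · apply Units.ext
        show (algebraMap (ZMod p) (GaloisField p 2) (-1)) ^ ((p + 1) / 2) = 1
        rw [map_neg, map_one]
        exact Even.neg_one_pow (by rw [Nat.even_iff]; omega)
end
end

section
/- Let k be an algebraically closed field of characteristic p, where p > 2 is prime, and let n = (p−3)/2. For σ = (a b; c d) ∈ SL₂(F_p), let σ act on the polynomial ring k[U,V] by the k-algebra map sending U ↦ a·U + b·V and V ↦ c·U + d·V (entries regarded in k). Then the space of homogeneous polynomials of degree n in k[U,V] is an irreducible SL₂(F_p)-representation: every k-subspace of the degree-n homogeneous component that is mapped into itself by the action of every σ ∈ SL₂(F_p) is either 0 or the whole degree-n homogeneous component. -/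
noncomputable section

theorem aux_coeff (p : ℕ) [Fact p.Prime] (k : Type) [Field k] [CharP k p]
    {E : Type} [AddCommGroup E] [Module k E] (W : Submodule k E) (n : ℕ) (hn : n < p)
    (v : ℕ → E)
    (h : ∀ t : ZMod p, ∑ j ∈ Finset.range (n + 1),
      ((ZMod.castHom (dvd_refl p) k t) ^ j) • v j ∈ W) :
    ∀ j ≤ n, v j ∈ W := by
  intro j hj
  by_contra hv
  obtain ⟨φ, hφ, hW⟩ := Submodule.exists_le_ker_of_notMem hv
  let q : Polynomial k := ∑ j ∈ Finset.range (n + 1), Polynomial.monomial j (φ (v j))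
  have hq : q = 0 := by
    apply Polynomial.eq_zero_of_natDegree_lt_card_of_eval_eq_zero q
      (f := ZMod.castHom (dvd_refl p) k) (RingHom.injective _)
    · intro t
      have := hW (h t)
      rw [LinearMap.mem_ker, map_sum] at this
      simp only [q, Polynomial.eval_finsetSum, Polynomial.eval_monomial]
      rw [← this]
      refine Finset.sum_congr rfl fun i _ => ?_
      rw [map_smul, smul_eq_mul, mul_comm]
    · rw [ZMod.card]
      refine lt_of_le_of_lt ?_ hn
      apply Polynomial.natDegree_sum_le_of_forall_le
      intro i hi
      exact (Polynomial.natDegree_monomial_le _).trans (by simpa [Nat.lt_succ_iff] using hi)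
  have : q.coeff j = φ (v j) := by
    simp [q, Polynomial.finsetSum_coeff, Polynomial.coeff_monomial]
    omega
  rw [hq] at this
  exact hφ (by simpa using this.symm)

theorem aux_poly (p : ℕ) [Fact p.Prime] (k : Type) [Field k] [CharP k p]
    {E : Type} [CommRing E] [Algebra k E] (W : Submodule k E) (n : ℕ) (hn : n < p)
    (g : Polynomial E) (hg : g.natDegree ≤ n)
    (h : ∀ t : ZMod p, g.eval (algebraMap k E (ZMod.castHom (dvd_refl p) k t)) ∈ W) :
    ∀ j ≤ n, g.coeff j ∈ W := by
  apply aux_coeff p k W n hn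
  intro t
  have := h t
  rw [Polynomial.eval_eq_sum_range' (Nat.lt_succ_of_le hg)] at this
  convert this using 2 with j
  rw [Algebra.smul_def, map_pow, mul_comm]

open MvPolynomial in
theorem aux_span (k : Type) [Field k] (n : ℕ) :
    homogeneousSubmodule (Fin 2) k n ≤
      Submodule.span k (Set.range fun i : Fin (n + 1) =>
        (X 0 ^ (i : ℕ) * X 1 ^ (n - i) : MvPolynomial (Fin 2) k)) := by
  intro f hf
  rw [mem_homogeneousSubmodule] at hf
  rw [f.as_sum]
  refine Submodule.sum_mem _ fun d hd => ?_
  have h1 := hf (mem_support_iff.mp hd)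
  have h2 : d 0 + d 1 = n := by
    rw [← h1]
    simp [Finsupp.weight_apply, Finsupp.sum_fintype]
  have h3 : monomial d (coeff d f) = coeff d f • (X 0 ^ (d 0) * X 1 ^ (n - d 0)) := by
    rw [monomial_eq, Finsupp.prod_fintype _ _ (by simp), Fin.prod_univ_two, smul_eq_C_mul]
    congr 3
    omega
  rw [h3]
  exact Submodule.smul_mem _ _ (Submodule.subset_span ⟨⟨d 0, by omega⟩, rfl⟩)

/-- Let `k` be an algebraically closed field of characteristic `p`,
where `p > 2` is prime, and let `n = (p−3)/2`.  For `σ = (a b; c d) ∈ SL₂(F_p)`, let `σ`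
act on `k[U,V]` by the `k`-algebra map sending `U ↦ a·U + b·V` and `V ↦ c·U + d·V`
(entries regarded in `k`).  Then the space of homogeneous polynomials of degree `n` is an
irreducible `SL₂(F_p)`-representation: every `k`-subspace of the degree-`n` homogeneous
component that is mapped into itself by every `σ ∈ SL₂(F_p)` is `0` or everything. -/
theorem stmt_12 (p : ℕ) [Fact p.Prime] (hp2 : 2 < p)
    (k : Type) [Field k] [IsAlgClosed k] [CharP k p]
    (M : Submodule k (MvPolynomial (Fin 2) k))
    (hM : M ≤ MvPolynomial.homogeneousSubmodule (Fin 2) k ((p - 3) / 2))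
    (hstab : ∀ σ : Matrix.SpecialLinearGroup (Fin 2) (ZMod p), ∀ f ∈ M,
      (MvPolynomial.aeval
        ![MvPolynomial.C (ZMod.castHom (dvd_refl p) k (σ.val 0 0)) * MvPolynomial.X 0 +
            MvPolynomial.C (ZMod.castHom (dvd_refl p) k (σ.val 0 1)) * MvPolynomial.X 1,
          MvPolynomial.C (ZMod.castHom (dvd_refl p) k (σ.val 1 0)) * MvPolynomial.X 0 +
            MvPolynomial.C (ZMod.castHom (dvd_refl p) k (σ.val 1 1)) * MvPolynomial.X 1]) f
        ∈ M) :
    M = ⊥ ∨ M = MvPolynomial.homogeneousSubmodule (Fin 2) k ((p - 3) / 2) := by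
  classical
  set n := (p - 3) / 2 with hn
  have hnp : n < p := by omega
  by_cases hbot : M = ⊥
  · exact Or.inl hbot
  right
  refine le_antisymm hM ((aux_span k n).trans ?_)
  rw [Submodule.span_le]
  obtain ⟨f, hfM, hf0⟩ := (Submodule.ne_bot_iff M).mp hbot
  obtain ⟨a, ha⟩ := (Submodule.mem_span_range_iff_exists_fun k).mp (aux_span k n (hM hfM))
  -- the highest power of `U` lies in `M`
  have hU : (MvPolynomial.X 0 ^ n : MvPolynomial (Fin 2) k) ∈ M := by
    have hex : ∃ i : ℕ, ∃ h : i < n + 1, a ⟨i, h⟩ ≠ 0 := by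
      by_contra hcon
      push Not at hcon
      apply hf0
      rw [← ha]
      refine Finset.sum_eq_zero fun i _ => ?_
      rw [hcon i.1 i.2, zero_smul]
    obtain ⟨hi0, hai0⟩ := Nat.find_spec hex
    have hmin : ∀ i : Fin (n + 1), i.1 < Nat.find hex → a i = 0 := by
      intro i hi
      have := Nat.find_min hex hi
      push Not at this
      exact this i.2
    generalize Nat.find hex = i0 at hi0 hai0 hmin
    let g : Polynomial (MvPolynomial (Fin 2) k) := ∑ i : Fin (n + 1),
      Polynomial.C (a i • MvPolynomial.X 0 ^ i.1) *
        (Polynomial.C (MvPolynomial.X 0) * Polynomial.X +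
          Polynomial.C (MvPolynomial.X 1)) ^ (n - i.1)
    have hdeg : ∀ m : ℕ, ((Polynomial.C (MvPolynomial.X 0 : MvPolynomial (Fin 2) k) *
        Polynomial.X + Polynomial.C (MvPolynomial.X 1)) ^ m).natDegree ≤ m := by
      intro m
      refine Polynomial.natDegree_pow_le.trans ?_
      have := Polynomial.natDegree_linear_le (a := (MvPolynomial.X 0 : MvPolynomial (Fin 2) k))
        (b := MvPolynomial.X 1)
      nlinarith
    have hg : g.natDegree ≤ n := by
      apply Polynomial.natDegree_sum_le_of_forall_le
      intro i _
      exact (Polynomial.natDegree_C_mul_le _ _).trans ((hdeg _).trans (Nat.sub_le _ _))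
    have key := aux_poly p k M n hnp g hg ?_ (n - i0) (Nat.sub_le _ _)
    · have hc : g.coeff (n - i0) = a ⟨i0, hi0⟩ • MvPolynomial.X 0 ^ n := by
        simp only [g, Polynomial.finsetSum_coeff, Polynomial.coeff_C_mul]
        rw [Finset.sum_eq_single (⟨i0, hi0⟩ : Fin (n + 1))]
        · have h1 := Polynomial.coeff_pow_of_natDegree_le (n := 1) (m := n - i0)
            (Polynomial.natDegree_linear_le
              (a := (MvPolynomial.X 0 : MvPolynomial (Fin 2) k)) (b := MvPolynomial.X 1))
          rw [mul_one] at h1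
          rw [h1]
          simp only [Polynomial.coeff_add, Polynomial.coeff_C_mul, Polynomial.coeff_X_one,
            Polynomial.coeff_C_succ, mul_one, add_zero]
          rw [smul_mul_assoc, ← pow_add]
          congr 2
          omega
        · intro i _ hi
          rcases lt_or_ge i.1 i0 with hlt | hge
          · rw [hmin i hlt, zero_smul, zero_mul]
          · have hne : i.1 ≠ i0 := fun h => hi (Fin.ext h)
            rw [Polynomial.coeff_eq_zero_of_natDegree_lt, mul_zero]
            have := hdeg (n - i.1)
            have := i.2
            omega
        · simp
      rw [hc] at key
      exact (Submodule.smul_mem_iff M hai0).mp key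
    · intro t
      have := hstab ⟨!![1, 0; t, 1], by simp [Matrix.det_fin_two]⟩ f hfM
      convert this using 1
      rw [← ha]
      simp only [g, Polynomial.eval_finsetSum, map_sum]
      refine Finset.sum_congr rfl fun i _ => ?_
      simp [MvPolynomial.algebraMap_eq]
      rw [mul_comm (MvPolynomial.X 0) (MvPolynomial.C _)]
  -- all monomials lie in `M`
  rintro _ ⟨i, rfl⟩
  have key := aux_poly p k M n hnp
    ((Polynomial.X * Polynomial.C (MvPolynomial.X 1 : MvPolynomial (Fin 2) k) +
      Polynomial.C (MvPolynomial.X 0)) ^ n) ?_ ?_ (n - i.1) (Nat.sub_le _ _)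
  · have hi := i.2
    have hc : ((Polynomial.X * Polynomial.C (MvPolynomial.X 1 : MvPolynomial (Fin 2) k) +
        Polynomial.C (MvPolynomial.X 0)) ^ n).coeff (n - i.1) =
        (n.choose (n - i.1) : k) • (MvPolynomial.X 0 ^ i.1 * MvPolynomial.X 1 ^ (n - i.1)) := by
      rw [add_pow, Polynomial.finsetSum_coeff, Finset.sum_eq_single (n - i.1)]
      · rw [mul_pow, mul_assoc, mul_assoc, Polynomial.coeff_X_pow_mul', if_pos le_rfl,
          Nat.sub_self, ← Polynomial.C_pow, ← Polynomial.C_pow, ← Polynomial.C_eq_natCast,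
          ← Polynomial.C_mul, ← Polynomial.C_mul, Polynomial.coeff_C_zero,
          MvPolynomial.smul_eq_C_mul, show n - (n - i.1) = i.1 by omega, map_natCast]
        ring
      · intro j _ hj
        rw [mul_pow, mul_assoc, mul_assoc, ← Polynomial.C_pow, ← Polynomial.C_pow,
          ← Polynomial.C_eq_natCast, ← Polynomial.C_mul, ← Polynomial.C_mul, mul_comm,
          Polynomial.coeff_C_mul_X_pow, if_neg (Ne.symm hj)]
      · intro h
        exact absurd (Finset.mem_range.mpr (by omega)) h
    rw [hc] at key
    refine (Submodule.smul_mem_iff M ?_).mp key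
    rw [Ne, CharP.cast_eq_zero_iff k p]
    intro hdvd
    have hfac := hdvd.trans (Dvd.intro _ rfl : n.choose (n - i.1) ∣
      n.choose (n - i.1) * ((n - i.1).factorial * (n - (n - i.1)).factorial) )
    rw [← mul_assoc, Nat.choose_mul_factorial_mul_factorial (Nat.sub_le _ _)] at hfac
    have := ((Fact.out : p.Prime).dvd_factorial).mp hfac
    omega
  · refine Polynomial.natDegree_pow_le.trans ?_
    have := Polynomial.natDegree_linear_le (a := (MvPolynomial.X 1 : MvPolynomial (Fin 2) k))
      (b := MvPolynomial.X 0)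
    rw [mul_comm (Polynomial.X)]
    nlinarith
  · intro t
    have := hstab ⟨!![1, t; 0, 1], by simp [Matrix.det_fin_two]⟩ _ hU
    convert this using 1
    simp [MvPolynomial.algebraMap_eq, add_comm]
    rw [mul_comm (MvPolynomial.X 1) (MvPolynomial.C _)]
end
end

section
/- Let f ∈ k[[t]] be the power series whose coefficient at degree m is 1 if m = 2pⁱ for some integer i ≥ 0 and 0 otherwise, regarded as an element of the field of formal Laurent series k((t)), and let f' denote its formal derivative. Let g = (p−1)/2. Then for all integers i, j with 0 ≤ i ≤ g−1 and 1 ≤ j ≤ g, the coefficient of t⁻¹ in the Laurent series f^{j−i−2}·f' equals 2 if j = i + 1, and equals 0 otherwise. (Equivalently, the residue at the point at infinity of x^{i−j} dx on the curve y² = xᵖ − x equals −2 if j = i + 1 and 0 otherwise.) -/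
noncomputable section

open scoped Classical

/-- The power series `f = Σ_{i ≥ 0} t^{2pⁱ}`: the expansion of `1/x` in the uniformizer
`t = y/x^{(p+1)/2}` at the point at infinity of the curve `y² = xᵖ − x`. -/
def serF (p : ℕ) (k : Type) [Field k] : PowerSeries k :=
  PowerSeries.mk fun m => if ∃ i : ℕ, m = 2 * p ^ i then (1 : k) else 0

theorem serF_factor (p : ℕ) (hp : p.Prime) (hp2 : 2 < p) (k : Type) [Field k] :
    ∃ w : PowerSeries k, serF p k = PowerSeries.X ^ 2 * (1 + PowerSeries.X ^ p * w) := by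
  have h : (PowerSeries.X : PowerSeries k) ^ (p + 2) ∣ serF p k - PowerSeries.X ^ 2 := by
    rw [PowerSeries.X_pow_dvd_iff]
    intro m hm
    rw [map_sub, PowerSeries.coeff_X_pow, serF, PowerSeries.coeff_mk, sub_eq_zero]
    congr 1
    apply propext
    constructor
    · rintro ⟨i, rfl⟩
      rcases i with _ | i
      · simp
      · exfalso
        have : 1 ≤ p ^ i := Nat.one_le_pow _ _ (by omega)
        rw [pow_succ] at hm
        nlinarith
    · rintro rfl
      exact ⟨0, by simp⟩
  obtain ⟨w, hw⟩ := h
  exact ⟨w, by linear_combination hw⟩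

theorem serF_deriv (p : ℕ) (hp : p.Prime) (hp2 : 2 < p) (k : Type) [Field k] [CharP k p] :
    PowerSeries.derivative k (serF p k) = PowerSeries.C (2 : k) * PowerSeries.X := by
  ext m
  rw [PowerSeries.coeff_derivative, PowerSeries.coeff_C_mul, PowerSeries.coeff_X, serF,
    PowerSeries.coeff_mk]
  by_cases hm : m = 1
  · subst hm
    rw [if_pos ⟨0, by simp⟩]
    norm_num
  · rw [if_neg hm]
    split_ifs with h
    · obtain ⟨i, hi⟩ := h
      rcases i with _ | i
      · simp at hi; omega
      · have : ((m + 1 : ℕ) : k) = 0 := by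
          rw [CharP.cast_eq_zero_iff k p, hi, pow_succ]
          exact ⟨2 * p ^ i, by ring⟩
        push_cast at this
        rw [this]; simp
    · simp

theorem unit_zpow (p : ℕ) (hp : 2 < p) (k : Type) [Field k] (w : PowerSeries k) (n : ℤ) :
    ∃ z : PowerSeries k, (z : LaurentSeries k) =
      ((1 + PowerSeries.X ^ p * w : PowerSeries k) : LaurentSeries k) ^ n ∧
      PowerSeries.X ^ p ∣ z - 1 := by
  set u : PowerSeries k := 1 + PowerSeries.X ^ p * w with hu
  have hu0 : PowerSeries.constantCoeff u ≠ 0 := by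
    simp [hu, show p ≠ 0 by omega]
  have key : ∀ (v : PowerSeries k) (N : ℕ), PowerSeries.X ^ p ∣ v - 1 →
      PowerSeries.X ^ p ∣ v ^ N - 1 := by
    intro v N h
    have := sub_dvd_pow_sub_pow v 1 N
    rw [one_pow] at this
    exact h.trans this
  have hd : PowerSeries.X ^ p ∣ u - 1 := ⟨w, by rw [hu]; ring⟩
  have hinv : u * u⁻¹ = 1 := PowerSeries.mul_inv_cancel u hu0
  have hd' : PowerSeries.X ^ p ∣ u⁻¹ - 1 := by
    refine ⟨- w * u⁻¹, ?_⟩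
    have : (1 + PowerSeries.X ^ p * w) * u⁻¹ = 1 := hinv
    linear_combination this
  obtain ⟨N, rfl | rfl⟩ := n.eq_nat_or_neg
  · exact ⟨u ^ N, by simp, key _ _ hd⟩
  · refine ⟨u⁻¹ ^ N, ?_, key _ _ hd'⟩
    have h1 : (u : LaurentSeries k) * ((u⁻¹ : PowerSeries k) : LaurentSeries k) = 1 := by
      rw [← PowerSeries.coe_mul, hinv, PowerSeries.coe_one]
    rw [PowerSeries.coe_pow, eq_inv_of_mul_eq_one_right h1, zpow_neg, zpow_natCast, inv_pow]

/-- Regard `f` as an element of the field of formal Laurent series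
`k((t))`, and let `f'` denote its formal derivative.  Let `g = (p−1)/2`.  Then for all
integers `i, j` with `0 ≤ i ≤ g−1` and `1 ≤ j ≤ g`, the coefficient of `t⁻¹` in the
Laurent series `f^{j−i−2}·f'` equals `2` if `j = i + 1`, and equals `0` otherwise.
(Equivalently, the residue at infinity of `x^{i−j} dx` on `y² = xᵖ − x` is `−2` if
`j = i + 1` and `0` otherwise.) -/
theorem stmt_14 (p : ℕ) (hp : p.Prime) (hp2 : 2 < p)
    (k : Type) [Field k] [CharP k p]
    (i j : ℤ) (hi0 : 0 ≤ i) (hi : i ≤ ((p - 1) / 2 : ℕ) - 1) (hj1 : 1 ≤ j)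
    (hj : j ≤ ((p - 1) / 2 : ℕ)) :
    (((serF p k : LaurentSeries k) ^ (j - i - 2) *
        (PowerSeries.derivative k (serF p k) : LaurentSeries k)).coeff (-1))
      = if j = i + 1 then (2 : k) else 0 := by
  obtain ⟨w, hw⟩ := serF_factor p hp hp2 k
  obtain ⟨z, hz, hzd⟩ := unit_zpow p hp2 k w (j - i - 2)
  rw [serF_deriv p hp hp2 k, hw, PowerSeries.coe_mul, mul_zpow, ← hz, PowerSeries.coe_mul,
    PowerSeries.coe_pow, PowerSeries.coe_X, PowerSeries.coe_C]
  have hX : (HahnSeries.single (1 : ℤ) (1 : k) : LaurentSeries k) ≠ 0 := by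
    simp
  have e : ((HahnSeries.single (1 : ℤ) (1 : k) : LaurentSeries k) ^ 2) ^ (j - i - 2) *
      (z : LaurentSeries k) * (HahnSeries.C 2 * HahnSeries.single (1 : ℤ) (1 : k)) =
      HahnSeries.C 2 * (HahnSeries.single (2 * (j - i - 2) + 1) (1 : k) *
        (z : LaurentSeries k)) := by
    have : (HahnSeries.single (2 * (j - i - 2) + 1) (1 : k) : LaurentSeries k) =
        ((HahnSeries.single (1 : ℤ) (1 : k) : LaurentSeries k) ^ 2) ^ (j - i - 2) *
          HahnSeries.single (1 : ℤ) (1 : k) := by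
      rw [← zpow_natCast, ← zpow_mul, ← zpow_add_one₀ hX]
      simpa using RatFunc.single_zpow (2 * (j - i - 2) + 1)
    rw [this]; ring
  rw [e, HahnSeries.C_mul_eq_smul, HahnSeries.coeff_smul,
    show (-1 : ℤ) = -2 * (j - i - 1) + (2 * (j - i - 2) + 1) by ring,
    HahnSeries.coeff_single_mul_add, one_mul, PowerSeries.coeff_coe]
  rw [PowerSeries.X_pow_dvd_iff] at hzd
  split_ifs with h1 h2 h2
  · omega
  · simp
  · have := hzd 0 (by omega)
    subst h2
    simp only [map_sub, PowerSeries.coeff_one, if_true, sub_eq_zero] at this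
    simp at this ⊢
    rw [this]; simp
  · have := hzd (-2 * (j - i - 1)).natAbs (by omega)
    rw [map_sub, PowerSeries.coeff_one, if_neg (by omega), sub_zero] at this
    rw [this, smul_zero]
end
end
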